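/- Let X be a metric space, p, q₁, q₂ probability measures on X with finite first moment, and λ ∈ [0,1]. Then W₁(λ q₁ + (1-λ) p, λ q₂ + (1-λ) p) = λ · W₁(q₁, q₂). -/

import Mathlib

open MeasureTheory
open scoped ENNReal

/-- The 1-Wasserstein distance, defined as the infimum over all couplings of the
expected distance. -/
noncomputable def W1 {X : Type*} [MeasurableSpace X] [PseudoEMetricSpace X]
    (p q : Measure X) : ℝ≥0∞ :=
  ⨅ r ∈ {r : Measure (X × X) | r.map Prod.fst = p ∧ r.map Prod.snd = q},
    ∫⁻ z, edist z.1 z.2 ∂r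

theorem indicator_one_iUnion {α : Type*} {f : ℕ → Set α} (hf : Pairwise (Function.onFun Disjoint f))
    (x : α) : (⋃ n, f n).indicator (1 : α → ℝ≥0∞) x = ∑' n, (f n).indicator 1 x := by
  by_cases hx : x ∈ ⋃ n, f n
  · obtain ⟨n, hn⟩ := Set.mem_iUnion.1 hx
    rw [tsum_eq_single n fun m hm ↦ Set.indicator_of_notMem
      (fun h ↦ Set.disjoint_left.1 (hf hm) h hn) _]
    simp [hx, hn]
  · simp only [Set.mem_iUnion, not_exists] at hx
    simp [hx]

/-- `h (x, y)` is a version of the conditional integral of `g x` given the first coordinate `y`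
under `r`, simultaneously for every selection `ξ` of the parameter `x` as a function of `y`. -/
structure IsFiberIntegral {X Y Z : Type*} [MeasurableSpace X] [MeasurableSpace Y]
    [MeasurableSpace Z] (r : Measure (Y × Z)) (g : X × Z → ℝ≥0∞) (h : X × Y → ℝ≥0∞) : Prop where
  measurable : Measurable h
  setLIntegral_eq : ∀ (ξ : Y → X) (C : Set Y),
    ∫⁻ y in C, h (ξ y, y) ∂(r.map Prod.fst) = ∫⁻ w in Prod.fst ⁻¹' C, g (ξ w.1, w.2) ∂r

namespace IsFiberIntegral

variable {X Y Z : Type*} [MeasurableSpace X] [MeasurableSpace Y] [MeasurableSpace Z]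
  [DiscreteMeasurableSpace Y] {r : Measure (Y × Z)} {g g' : X × Z → ℝ≥0∞} {h h' : X × Y → ℝ≥0∞}

theorem measurable_selection (ξ : Y → X) :
    Measurable (fun w : Y × Z ↦ (ξ w.1, w.2)) :=
  ((Measurable.of_discrete (f := ξ)).comp measurable_fst).prodMk measurable_snd

theorem measurable_comp_selection (hg : Measurable g) (ξ : Y → X) :
    Measurable (fun w : Y × Z ↦ g (ξ w.1, w.2)) :=
  hg.comp (measurable_selection ξ)

theorem measurable_graph (hh : Measurable h) (ξ : Y → X) :
    Measurable (fun y ↦ h (ξ y, y)) :=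
  hh.comp ((Measurable.of_discrete (f := ξ)).prodMk measurable_id)

theorem ae_le [Nonempty X] [IsFiniteMeasure r] (hg : IsFiberIntegral r g h)
    (hg' : IsFiberIntegral r g' h') (hle : g ≤ g') :
    ∀ᵐ y ∂(r.map Prod.fst), ∀ x, h (x, y) ≤ h' (x, y) := by
  classical
  have hsel : ∀ y, ∃ x, (∃ x', h' (x', y) < h (x', y)) → h' (x, y) < h (x, y) := fun y ↦ by
    by_cases hx : ∃ x', h' (x', y) < h (x', y)
    · exact ⟨hx.choose, fun _ ↦ hx.choose_spec⟩
    · exact ⟨Classical.arbitrary X, fun h ↦ absurd h hx⟩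
  choose ξ hξ using hsel
  have key : (fun y ↦ h (ξ y, y)) ≤ᵐ[r.map Prod.fst] fun y ↦ h' (ξ y, y) := by
    refine ae_le_of_forall_setLIntegral_le_of_sigmaFinite
      (measurable_graph hg.measurable ξ) fun C _ _ ↦ ?_
    rw [hg.setLIntegral_eq, hg'.setLIntegral_eq]
    exact lintegral_mono fun w ↦ hle _
  filter_upwards [key] with y hy x
  by_contra! hx
  exact absurd hy (not_le.2 (hξ y ⟨x, hx⟩))

theorem ae_eq [Nonempty X] [IsFiniteMeasure r] (hg : IsFiberIntegral r g h)
    (hg' : IsFiberIntegral r g h') :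
    ∀ᵐ y ∂(r.map Prod.fst), ∀ x, h (x, y) = h' (x, y) := by
  filter_upwards [hg.ae_le hg' le_rfl, hg'.ae_le hg le_rfl] with y h₁ h₂ x
  exact le_antisymm (h₁ x) (h₂ x)

theorem add (hgm : Measurable g) (hg : IsFiberIntegral r g h) (hg' : IsFiberIntegral r g' h') :
    IsFiberIntegral r (g + g') (h + h') where
  measurable := hg.measurable.add hg'.measurable
  setLIntegral_eq ξ C := by
    simp only [Pi.add_apply]
    rw [lintegral_add_left (measurable_graph hg.measurable ξ),
      lintegral_add_left (measurable_comp_selection hgm ξ),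
      hg.setLIntegral_eq, hg'.setLIntegral_eq]

theorem const_mul (hgm : Measurable g) (hg : IsFiberIntegral r g h) (c : ℝ≥0∞) :
    IsFiberIntegral r (fun w ↦ c * g w) (fun w ↦ c * h w) where
  measurable := hg.measurable.const_mul c
  setLIntegral_eq ξ C := by
    rw [lintegral_const_mul _ (measurable_graph hg.measurable ξ),
      lintegral_const_mul _ (measurable_comp_selection hgm ξ), hg.setLIntegral_eq]

theorem tsum {g : ℕ → X × Z → ℝ≥0∞} {h : ℕ → X × Y → ℝ≥0∞} (hgm : ∀ n, Measurable (g n))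
    (hg : ∀ n, IsFiberIntegral r (g n) (h n)) :
    IsFiberIntegral r (fun w ↦ ∑' n, g n w) (fun w ↦ ∑' n, h n w) where
  measurable := Measurable.tsum fun n ↦ (hg n).measurable
  setLIntegral_eq ξ C := by
    rw [lintegral_tsum fun n ↦ (measurable_graph (hg n).measurable ξ).aemeasurable,
      lintegral_tsum fun n ↦ (measurable_comp_selection (hgm n) ξ).aemeasurable]
    exact tsum_congr fun n ↦ (hg n).setLIntegral_eq ξ C

theorem comp_fst {f : X → ℝ≥0∞} (hf : Measurable f) :
    IsFiberIntegral r (fun w : X × Z ↦ f w.1) (fun w : X × Y ↦ f w.1) where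
  measurable := hf.comp measurable_fst
  setLIntegral_eq ξ _ :=
    setLIntegral_map .of_discrete (hf.comp (.of_discrete (f := ξ))) measurable_fst

theorem prod_indicator [IsFiniteMeasure r] {A : Set X} {B : Set Z} (hA : MeasurableSet A)
    (hB : MeasurableSet B) :
    IsFiberIntegral r ((A ×ˢ B).indicator 1) (fun w : X × Y ↦ A.indicator 1 w.1 *
      ((r.restrict (Prod.snd ⁻¹' B)).map Prod.fst).rnDeriv (r.map Prod.fst) w.2) where
  measurable := ((measurable_one.indicator hA).comp measurable_fst).mul
    ((Measure.measurable_rnDeriv _ _).comp measurable_snd)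
  setLIntegral_eq ξ C := by
    classical
    have hac : (r.restrict (Prod.snd ⁻¹' B)).map Prod.fst ≪ r.map Prod.fst :=
      (Measure.absolutelyContinuous_of_le Measure.restrict_le_self).map measurable_fst
    have hD : MeasurableSet (ξ ⁻¹' A ∩ C) := .of_discrete
    have h₁ : ∀ y, A.indicator (1 : X → ℝ≥0∞) (ξ y) *
        ((r.restrict (Prod.snd ⁻¹' B)).map Prod.fst).rnDeriv (r.map Prod.fst) y =
        (ξ ⁻¹' A).indicator
          (((r.restrict (Prod.snd ⁻¹' B)).map Prod.fst).rnDeriv (r.map Prod.fst)) y := by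
      intro y
      by_cases hy : ξ y ∈ A <;> simp [Set.indicator, hy]
    have h₂ : ∀ w : Y × Z, (A ×ˢ B).indicator (1 : X × Z → ℝ≥0∞) (ξ w.1, w.2) =
        ((fun w : Y × Z ↦ (ξ w.1, w.2)) ⁻¹' (A ×ˢ B)).indicator 1 w := fun w ↦ rfl
    simp only [h₁, h₂]
    rw [lintegral_indicator .of_discrete, Measure.restrict_restrict .of_discrete,
      Measure.setLIntegral_rnDeriv hac, Measure.map_apply measurable_fst hD,
      Measure.restrict_apply (measurable_fst hD),
      lintegral_indicator_one (measurable_selection ξ (hA.prod hB)),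
      Measure.restrict_apply (measurable_selection ξ (hA.prod hB))]
    congr 1
    ext w
    simp only [Set.mem_inter_iff, Set.mem_preimage, Set.mem_prod]
    tauto

theorem exists_indicator [Nonempty X] [IsFiniteMeasure r] {E : Set (X × Z)}
    (hE : MeasurableSet E) : ∃ h : X × Y → ℝ≥0∞, IsFiberIntegral r (E.indicator 1) h := by
  induction E, hE using MeasurableSpace.induction_on_inter generateFrom_prod.symm
    isPiSystem_prod with
  | empty =>
    refine ⟨fun _ ↦ 0, measurable_const, fun ξ C ↦ by simp⟩
  | basic t ht =>
    obtain ⟨A, hA, B, hB, rfl⟩ := ht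
    exact ⟨_, prod_indicator hA hB⟩
  | compl t ht ih =>
    obtain ⟨h, hh⟩ := ih
    have h_one : IsFiberIntegral r (fun _ : X × Z ↦ 1) (fun _ : X × Y ↦ 1) :=
      comp_fst (f := fun _ ↦ 1) measurable_const
    have hle := hh.ae_le h_one (Set.indicator_le_self' (by simp))
    refine ⟨fun w ↦ 1 - h w, measurable_const.sub hh.measurable, fun ξ C ↦ ?_⟩
    have hm := measurable_graph hh.measurable ξ
    have hmt : Measurable fun w : Y × Z ↦ t.indicator (1 : X × Z → ℝ≥0∞) (ξ w.1, w.2) :=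
      (measurable_one.indicator ht).comp (measurable_selection ξ)
    have hfin : ∫⁻ y in C, h (ξ y, y) ∂(r.map Prod.fst) ≠ ∞ := by
      refine ne_top_of_le_ne_top (measure_ne_top (r.map Prod.fst) C) ?_
      rw [← setLIntegral_one]
      exact lintegral_mono_ae (ae_restrict_of_ae (hle.mono fun y hy ↦ hy _))
    rw [lintegral_sub hm hfin (ae_restrict_of_ae (hle.mono fun y hy ↦ hy _)),
      h_one.setLIntegral_eq ξ C, hh.setLIntegral_eq]
    rw [hh.setLIntegral_eq] at hfin
    rw [← lintegral_sub (f := fun _ ↦ 1) hmt hfin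
      (.of_forall fun w ↦ Set.indicator_le_self' (by simp) _)]
    refine lintegral_congr fun w ↦ ?_
    by_cases hw : (ξ w.1, w.2) ∈ t <;> simp [hw]
  | iUnion f hd hf ih =>
    choose h hh using ih
    refine ⟨fun w ↦ ∑' n, h n w, ?_⟩
    convert! tsum (fun n ↦ measurable_one.indicator (hf n)) hh using 1
    ext w
    exact indicator_one_iUnion hd w

/-- Along every selection `ξ`, the excess of the fiber integral over `α` costs at most the
integral of the excess. -/
theorem lintegral_sub_le [IsFiniteMeasure r] (hg : IsFiberIntegral r g h) {M : ℝ≥0∞} (hM : M ≠ ∞)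
    (hgM : ∀ w, g w ≤ M) (ξ : Y → X) (α : Y → ℝ≥0∞) :
    ∫⁻ y, h (ξ y, y) - α y ∂(r.map Prod.fst) ≤ ∫⁻ w, g (ξ w.1, w.2) - α w.1 ∂r := by
  have hα : Measurable α := .of_discrete
  have hgr := measurable_graph hg.measurable ξ
  let C : Set Y := {y | α y ≤ h (ξ y, y)}
  have hC : MeasurableSet C := .of_discrete
  have hαC : ∫⁻ y in C, α y ∂(r.map Prod.fst) ≤ ∫⁻ y in C, h (ξ y, y) ∂(r.map Prod.fst) :=
    setLIntegral_mono hgr fun y hy ↦ hy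
  have hfin : ∫⁻ y in C, α y ∂(r.map Prod.fst) ≠ ∞ := by
    refine ne_top_of_le_ne_top ?_ hαC
    rw [hg.setLIntegral_eq]
    refine ne_top_of_le_ne_top ?_ (lintegral_mono fun w ↦ hgM (ξ w.1, w.2))
    rw [lintegral_const]
    exact ENNReal.mul_ne_top hM (measure_ne_top _ _)
  calc ∫⁻ y, h (ξ y, y) - α y ∂(r.map Prod.fst)
      = ∫⁻ y in C, h (ξ y, y) - α y ∂(r.map Prod.fst) := by
        rw [← lintegral_indicator hC]
        refine lintegral_congr fun y ↦ ?_
        by_cases hy : y ∈ C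
        · simp [hy]
        · simp only [hy, not_false_eq_true, Set.indicator_of_notMem]
          exact tsub_eq_zero_of_le (not_le.1 hy).le
    _ = ∫⁻ y in C, h (ξ y, y) ∂(r.map Prod.fst) - ∫⁻ y in C, α y ∂(r.map Prod.fst) :=
        lintegral_sub hα hfin ((ae_restrict_iff' hC).2 (.of_forall fun y hy ↦ hy))
    _ ≤ ∫⁻ w in Prod.fst ⁻¹' C, g (ξ w.1, w.2) - α w.1 ∂r := by
        rw [tsub_le_iff_right, hg.setLIntegral_eq, setLIntegral_map hC hα measurable_fst,
          ← lintegral_add_right (g := fun w : Y × Z ↦ α w.1) _ (hα.comp measurable_fst)]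
        exact lintegral_mono fun w ↦ le_tsub_add
    _ ≤ ∫⁻ w, g (ξ w.1, w.2) - α w.1 ∂r := setLIntegral_le_lintegral _ _

end IsFiberIntegral

section Gluing

variable {X Y Z : Type*} [MeasurableSpace X] [MeasurableSpace Y] [MeasurableSpace Z]
  [DiscreteMeasurableSpace Y] [Nonempty X] {r₁ : Measure (X × Y)} {r₂ : Measure (Y × Z)}
  [IsFiniteMeasure r₂]

theorem IsFiberIntegral.lintegral_eq (hr : r₁.map Prod.snd = r₂.map Prod.fst)
    {g : X × Z → ℝ≥0∞} {h h' : X × Y → ℝ≥0∞}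
    (hg : IsFiberIntegral r₂ g h) (hg' : IsFiberIntegral r₂ g h') :
    ∫⁻ v, h v ∂r₁ = ∫⁻ v, h' v ∂r₁ := by
  have hae := hg.ae_eq hg'
  rw [← hr] at hae
  exact lintegral_congr_ae ((ae_of_ae_map measurable_snd.aemeasurable hae).mono fun v hv ↦ hv v.1)

variable (r₁ r₂) in
/-- The conditionally independent gluing of `r₁` and `r₂` along their common marginal on a
discrete space, as a measure on the two outer coordinates. -/
noncomputable def discreteGluing (hr : r₁.map Prod.snd = r₂.map Prod.fst) : Measure (X × Z) :=
  Measure.ofMeasurable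
    (fun _ hE ↦ ∫⁻ v, (IsFiberIntegral.exists_indicator (r := r₂) hE).choose v ∂r₁)
    (by
      have h_zero : IsFiberIntegral r₂ ((∅ : Set (X × Z)).indicator 1) (fun _ ↦ 0) :=
        ⟨measurable_const, fun ξ C ↦ by simp⟩
      rw [(Exists.choose_spec _ : IsFiberIntegral r₂ _ _).lintegral_eq hr h_zero, lintegral_zero])
    (fun f hf hd ↦ by
      have hh := fun n ↦ (IsFiberIntegral.exists_indicator (r := r₂) (hf n)).choose_spec
      have hsum := IsFiberIntegral.tsum (fun n ↦ measurable_one.indicator (hf n)) hh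
      simp only [← indicator_one_iUnion hd] at hsum
      rw [(Exists.choose_spec _ : IsFiberIntegral r₂ _ _).lintegral_eq hr hsum,
        lintegral_tsum fun n ↦ (hh n).measurable.aemeasurable])

theorem discreteGluing_apply (hr : r₁.map Prod.snd = r₂.map Prod.fst) {E : Set (X × Z)}
    (hE : MeasurableSet E) {h : X × Y → ℝ≥0∞} (hh : IsFiberIntegral r₂ (E.indicator 1) h) :
    discreteGluing r₁ r₂ hr E = ∫⁻ v, h v ∂r₁ := by
  rw [discreteGluing, Measure.ofMeasurable_apply E hE]
  exact (Exists.choose_spec _ : IsFiberIntegral r₂ _ _).lintegral_eq hr hh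

theorem discreteGluing_map_fst (hr : r₁.map Prod.snd = r₂.map Prod.fst) :
    (discreteGluing r₁ r₂ hr).map Prod.fst = r₁.map Prod.fst := by
  ext A hA
  rw [Measure.map_apply measurable_fst hA, Measure.map_apply measurable_fst hA,
    discreteGluing_apply hr (measurable_fst hA)
      (IsFiberIntegral.comp_fst (measurable_one.indicator hA)),
    ← lintegral_indicator_one (measurable_fst hA)]
  rfl

theorem discreteGluing_map_snd (hr : r₁.map Prod.snd = r₂.map Prod.fst) :
    (discreteGluing r₁ r₂ hr).map Prod.snd = r₂.map Prod.snd := by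
  ext B hB
  have hac : (r₂.restrict (Prod.snd ⁻¹' B)).map Prod.fst ≪ r₂.map Prod.fst :=
    (Measure.absolutelyContinuous_of_le Measure.restrict_le_self).map measurable_fst
  rw [Measure.map_apply measurable_snd hB, Measure.map_apply measurable_snd hB,
    ← Set.univ_prod, discreteGluing_apply hr (MeasurableSet.univ.prod hB)
      (IsFiberIntegral.prod_indicator .univ hB)]
  simp only [Set.indicator_univ, Pi.one_apply, one_mul]
  rw [← lintegral_map (Measure.measurable_rnDeriv _ _) measurable_snd, hr,
    Measure.lintegral_rnDeriv hac, Measure.map_apply measurable_fst .univ]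
  simp

theorem exists_isFiberIntegral_simpleFunc (hr : r₁.map Prod.snd = r₂.map Prod.fst)
    (g : SimpleFunc (X × Z) NNReal) :
    ∃ h : X × Y → ℝ≥0∞, IsFiberIntegral r₂ (fun w ↦ (g w : ℝ≥0∞)) h ∧
      ∫⁻ w, g w ∂(discreteGluing r₁ r₂ hr) = ∫⁻ v, h v ∂r₁ := by
  induction g using SimpleFunc.induction with
  | const c hs =>
    rename_i s
    obtain ⟨h, hh⟩ := IsFiberIntegral.exists_indicator (r := r₂) hs
    have hm : Measurable (s.indicator (1 : X × Z → ℝ≥0∞)) := measurable_one.indicator hs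
    have heq : (fun w ↦ ((SimpleFunc.piecewise s hs (SimpleFunc.const _ c)
        (SimpleFunc.const _ 0) w : NNReal) : ℝ≥0∞)) = fun w ↦ (c : ℝ≥0∞) * s.indicator 1 w := by
      ext w
      by_cases hw : w ∈ s <;> simp [hw]
    rw [heq]
    refine ⟨_, hh.const_mul hm c, ?_⟩
    rw [lintegral_const_mul _ hm, lintegral_const_mul _ hh.measurable, lintegral_indicator_one hs,
      discreteGluing_apply hr hs hh]
  | @add f g _ hf hg =>
    obtain ⟨h, hh, hint⟩ := hf
    obtain ⟨h', hh', hint'⟩ := hg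
    have hm : Measurable fun w ↦ (f w : ℝ≥0∞) := f.measurable.coe_nnreal_ennreal
    have heq : (fun w ↦ (((f + g) w : NNReal) : ℝ≥0∞)) =
        (fun w ↦ (f w : ℝ≥0∞)) + fun w ↦ (g w : ℝ≥0∞) := by
      ext w
      simp
    rw [heq]
    refine ⟨_, hh.add hm hh', ?_⟩
    simp only [Pi.add_def]
    rw [lintegral_add_left hm, lintegral_add_left hh.measurable, hint, hint']

/-- The cost of the gluing is subadditive, for cost functions without any measurability. -/
theorem lintegral_discreteGluing_le (hr : r₁.map Prod.snd = r₂.map Prod.fst)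
    {a : X × Y → ℝ≥0∞} {b : Y × Z → ℝ≥0∞} {c : X × Z → ℝ≥0∞}
    (habc : ∀ x y z, c (x, z) ≤ a (x, y) + b (y, z)) :
    ∫⁻ w, c w ∂(discreteGluing r₁ r₂ hr) ≤ ∫⁻ v, a v ∂r₁ + ∫⁻ w, b w ∂r₂ := by
  rw [lintegral_eq_nnreal]
  refine iSup₂_le fun g hgc ↦ ?_
  obtain ⟨h, hh, hint⟩ := exists_isFiberIntegral_simpleFunc hr g
  rw [← SimpleFunc.lintegral_eq_lintegral]
  simp only [SimpleFunc.map_apply]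
  rw [hint]
  obtain ⟨M, hM⟩ := g.range.exists_le
  have hgM : ∀ w, (g w : ℝ≥0∞) ≤ M := fun w ↦ by
    exact_mod_cast hM _ (SimpleFunc.mem_range_self g w)
  let L : Y → ℝ≥0∞ := fun y ↦ sSup (Set.range fun x ↦ h (x, y) - a (x, y))
  have hL : Measurable L := .of_discrete
  have hLle : ∫⁻ y, L y ∂(r₂.map Prod.fst) ≤ ∫⁻ w, b w ∂r₂ := by
    have hseq := fun y ↦ exists_seq_tendsto_sSup
      (Set.range_nonempty fun x ↦ h (x, y) - a (x, y)) (OrderTop.bddAbove _)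
    choose u hu_mono hu_tendsto hu_mem using hseq
    choose ξ hξ using hu_mem
    refine le_of_tendsto' (lintegral_tendsto_of_tendsto_of_monotone
      (f := fun n y ↦ u y n) (fun n ↦ Measurable.of_discrete.aemeasurable)
      (.of_forall hu_mono) (.of_forall hu_tendsto)) fun n ↦ ?_
    simp only [← hξ]
    refine (hh.lintegral_sub_le ENNReal.coe_ne_top hgM (fun y ↦ ξ y n)
      fun y ↦ a (ξ y n, y)).trans (lintegral_mono fun w ↦ ?_)
    rw [tsub_le_iff_left]
    exact (hgc _).trans (habc _ _ _)
  calc ∫⁻ v, h v ∂r₁ ≤ ∫⁻ v, a v + L v.2 ∂r₁ := by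
        refine lintegral_mono fun v ↦ ?_
        rw [← tsub_le_iff_left]
        exact le_sSup ⟨v.1, rfl⟩
    _ = ∫⁻ v, a v ∂r₁ + ∫⁻ y, L y ∂(r₂.map Prod.fst) := by
        rw [lintegral_add_right (g := fun v : X × Y ↦ L v.2) _ (hL.comp measurable_snd), ← hr,
          lintegral_map hL measurable_snd]
    _ ≤ ∫⁻ v, a v ∂r₁ + ∫⁻ w, b w ∂r₂ := by gcongr

end Gluing

/-- Every metric space admits, at each scale, a retraction onto a discrete set of points all of
whose fibers, and unions of fibers, are Borel. -/
theorem exists_measurable_discretization {X : Type*} [MetricSpace X] [MeasurableSpace X]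
    [BorelSpace X] {ε : ℝ} (hε : 0 < ε) :
    ∃ π : X → X, (∀ S : Set X, MeasurableSet (π ⁻¹' S)) ∧ ∀ x, dist x (π x) < ε := by
  have wf : WellFounded (WellOrderingRel (α := X)) := WellOrderingRel.isWellOrder.wf
  have hne : ∀ x : X, {i | dist x i < ε}.Nonempty := fun x ↦ ⟨x, by simpa using hε⟩
  let π : X → X := fun x ↦ wf.min _ (hne x)
  have hπ : ∀ x, dist x (π x) < ε := fun x ↦ wf.min_mem _ (hne x)
  have hmin : ∀ x i, WellOrderingRel i (π x) → ε ≤ dist x i := fun x i hi ↦ by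
    by_contra! hlt
    exact wf.not_lt_min {i | dist x i < ε} hlt hi
  refine ⟨π, fun S ↦ ?_, hπ⟩
  let T : ℕ → Set X := fun n ↦ {x | π x ∈ S ∧ dist x (π x) ≤ ε - 1 / ((n : ℝ) + 1)}
  have hT : π ⁻¹' S = ⋃ n, closure (T n) := by
    refine Set.Subset.antisymm (fun x hx ↦ ?_) (Set.iUnion_subset fun n x hx ↦ ?_)
    · obtain ⟨n, hn⟩ := exists_nat_one_div_lt (sub_pos.2 (hπ x))
      exact Set.mem_iUnion.2 ⟨n, subset_closure ⟨hx, by linarith⟩⟩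
    · have hn : (0 : ℝ) < 1 / ((n : ℝ) + 1) := by positivity
      obtain ⟨u, ⟨huS, hu⟩, hxu⟩ := Metric.mem_closure_iff.1 hx
        (min (1 / ((n : ℝ) + 1)) (ε - dist x (π x))) (lt_min hn (sub_pos.2 (hπ x)))
      obtain ⟨hxu₁, hxu₂⟩ := lt_min_iff.1 hxu
      rcases trichotomous_of WellOrderingRel (π u) (π x) with h | h | h
      · have := hmin x _ h
        linarith [dist_triangle x u (π u)]
      · exact (h ▸ huS : π x ∈ S)
      · have := hmin u _ h
        linarith [dist_triangle u x (π x), dist_comm u x]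
  rw [hT]
  exact .iUnion fun n ↦ isClosed_closure.measurableSet

theorem tendsto_add_inv_natCast_mul (a : ℝ≥0∞) {b : ℝ≥0∞} (hb : b ≠ ∞) :
    Filter.Tendsto (fun n : ℕ ↦ a + (n : ℝ≥0∞)⁻¹ * b) Filter.atTop (nhds a) := by
  simpa using tendsto_const_nhds.add
    (ENNReal.Tendsto.mul_const ENNReal.tendsto_inv_nat_nhds_zero (Or.inr hb))

section W1

variable {X : Type*} [MetricSpace X] [MeasurableSpace X]

theorem W1_le_lintegral {μ ν : Measure X} {r : Measure (X × X)} (h₁ : r.map Prod.fst = μ)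
    (h₂ : r.map Prod.snd = ν) : W1 μ ν ≤ ∫⁻ z, edist z.1 z.2 ∂r :=
  iInf₂_le r ⟨h₁, h₂⟩

theorem isFiniteMeasure_of_map_fst {α β : Type*} [MeasurableSpace α] [MeasurableSpace β]
    {μ : Measure α} [IsFiniteMeasure μ] {r : Measure (α × β)} (h : r.map Prod.fst = μ) :
    IsFiniteMeasure r := by
  refine ⟨?_⟩
  rw [← Set.preimage_univ (f := Prod.fst), ← Measure.map_apply measurable_fst .univ, h]
  exact measure_lt_top μ _

theorem W1_add_add_le (μ ν μ' ν' : Measure X) :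
    W1 (μ + μ') (ν + ν') ≤ W1 μ ν + W1 μ' ν' := by
  refine ENNReal.le_iInf₂_add_iInf₂ fun r ⟨h₁, h₂⟩ r' ⟨h₁', h₂'⟩ ↦ ?_
  rw [← lintegral_add_measure]
  refine W1_le_lintegral ?_ ?_
  · rw [Measure.map_add _ _ measurable_fst, h₁, h₁']
  · rw [Measure.map_add _ _ measurable_snd, h₂, h₂']

theorem W1_self (μ : Measure X) : W1 μ μ = 0 := by
  have hd : Measurable fun x : X ↦ (x, x) := measurable_id.prodMk measurable_id
  refine le_antisymm ((W1_le_lintegral (r := μ.map fun x ↦ (x, x)) ?_ ?_).trans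
    ((lintegral_map_le _ _).trans ?_)) zero_le
  · rw [Measure.map_map measurable_fst hd]
    exact Measure.map_id
  · rw [Measure.map_map measurable_snd hd]
    exact Measure.map_id
  · simp

theorem W1_add_right_le (μ₁ μ₂ ν : Measure X) : W1 (μ₁ + ν) (μ₂ + ν) ≤ W1 μ₁ μ₂ := by
  simpa [W1_self] using W1_add_add_le μ₁ μ₂ ν ν

theorem W1_smul_le (c : NNReal) (μ ν : Measure X) : W1 (c • μ) (c • ν) ≤ c * W1 μ ν := by
  rcases eq_or_ne c 0 with rfl | hc
  · simp [W1_self]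
  have hc' : (c : ℝ≥0∞) ≠ 0 := by simpa using hc
  rw [W1.eq_def μ ν, ENNReal.mul_iInf_of_ne hc' ENNReal.coe_ne_top]
  simp only [ENNReal.mul_iInf_of_ne hc' ENNReal.coe_ne_top]
  refine le_iInf₂ fun r ⟨h₁, h₂⟩ ↦ ?_
  refine (W1_le_lintegral (r := c • r) ?_ ?_).trans ?_
  · rw [Measure.map_smul, h₁]
  · rw [Measure.map_smul, h₂]
  · rw [lintegral_smul_measure, ENNReal.smul_def, smul_eq_mul]

theorem mul_W1_le {c : NNReal} (hc : c ≠ 0) (μ ν : Measure X) :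
    c * W1 μ ν ≤ W1 (c • μ) (c • ν) := by
  have h := W1_smul_le c⁻¹ (c • μ) (c • ν)
  rw [smul_smul, smul_smul, inv_mul_cancel₀ hc, one_smul, one_smul, ENNReal.coe_inv hc] at h
  calc c * W1 μ ν ≤ c * ((c : ℝ≥0∞)⁻¹ * W1 (c • μ) (c • ν)) := by gcongr
    _ = W1 (c • μ) (c • ν) := by
      rw [← mul_assoc, ENNReal.mul_inv_cancel (by simpa using hc) ENNReal.coe_ne_top, one_mul]

theorem W1_triangle [BorelSpace X] [Nonempty X] (μ ν ρ : Measure X) [IsFiniteMeasure μ]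
    [IsFiniteMeasure ν] : W1 μ ρ ≤ W1 μ ν + W1 ν ρ := by
  refine ENNReal.le_iInf₂_add_iInf₂ fun r₁ ⟨h₁, h₁'⟩ r₂ ⟨h₂, h₂'⟩ ↦ ?_
  have := isFiniteMeasure_of_map_fst h₁
  have := isFiniteMeasure_of_map_fst h₂
  have key : ∀ ε : NNReal, 0 < ε → W1 μ ρ ≤ (∫⁻ z, edist z.1 z.2 ∂r₁ + ∫⁻ z, edist z.1 z.2 ∂r₂) +
      ε * (r₁ Set.univ + r₂ Set.univ) := by
    intro ε hε
    rw [mul_add, add_add_add_comm]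
    obtain ⟨π, hπm, hπ⟩ := exists_measurable_discretization (X := X) (NNReal.coe_pos.2 hε)
    have hπe : ∀ x, edist x (π x) ≤ ε := fun x ↦ by
      rw [edist_nndist]
      exact_mod_cast (hπ x).le
    obtain ⟨Y, mY, hY, p, e, hp, hpe⟩ : ∃ (Y : Type _) (_ : MeasurableSpace Y)
        (_ : DiscreteMeasurableSpace Y) (p : X → Y) (e : Y → X), Measurable p ∧
        ∀ x, edist x (e (p x)) ≤ ε :=
      ⟨X, ⊤, @DiscreteMeasurableSpace.mk X ⊤ fun _ ↦ trivial, π, id, fun S _ ↦ hπm S, hπe⟩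
    have hm₁ : Measurable fun z : X × X ↦ (z.1, p z.2) :=
      measurable_fst.prodMk (hp.comp measurable_snd)
    have hm₂ : Measurable fun z : X × X ↦ (p z.1, z.2) :=
      (hp.comp measurable_fst).prodMk measurable_snd
    have hr : (r₁.map fun z ↦ (z.1, p z.2)).map Prod.snd =
        (r₂.map fun z ↦ (p z.1, z.2)).map Prod.fst := by
      rw [Measure.map_map measurable_snd hm₁, Measure.map_map measurable_fst hm₂]
      change r₁.map (p ∘ Prod.snd) = r₂.map (p ∘ Prod.fst)
      rw [← Measure.map_map hp measurable_snd, ← Measure.map_map hp measurable_fst, h₁', h₂]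
    refine (W1_le_lintegral (r := discreteGluing _ _ hr) ?_ ?_).trans ?_
    · rw [discreteGluing_map_fst, Measure.map_map measurable_fst hm₁]
      exact h₁
    · rw [discreteGluing_map_snd, Measure.map_map measurable_snd hm₂]
      exact h₂'
    refine (lintegral_discreteGluing_le hr (a := fun v ↦ edist v.1 (e v.2))
      (b := fun w ↦ edist (e w.1) w.2) fun x y z ↦ edist_triangle _ _ _).trans ?_
    refine add_le_add ((lintegral_map_le _ _).trans ?_) ((lintegral_map_le _ _).trans ?_)
    · rw [← lintegral_const, ← lintegral_add_right _ measurable_const]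
      exact lintegral_mono fun z ↦ (edist_triangle _ z.2 _).trans (add_le_add_right (hpe _) _)
    · rw [← lintegral_const, ← lintegral_add_right _ measurable_const]
      refine lintegral_mono fun z ↦ (edist_triangle _ z.1 _).trans ?_
      rw [add_comm, edist_comm (e _)]
      exact add_le_add_right (hpe _) _
  refine ge_of_tendsto (tendsto_add_inv_natCast_mul _
    (ENNReal.add_ne_top.2 ⟨measure_ne_top r₁ Set.univ, measure_ne_top r₂ Set.univ⟩)) ?_
  filter_upwards [Filter.eventually_ne_atTop 0] with n hn
  have hn' : (n : NNReal) ≠ 0 := by exact_mod_cast hn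
  simpa [ENNReal.coe_inv hn'] using key (n : NNReal)⁻¹ (by positivity)

theorem W1_natCast_smul_add_le [BorelSpace X] [Nonempty X] (μ₁ μ₂ ν : Measure X)
    [IsFiniteMeasure μ₁] [IsFiniteMeasure μ₂] [IsFiniteMeasure ν] (n : ℕ) :
    W1 ((n : NNReal) • μ₁ + ν) ((n : NNReal) • μ₂ + ν) ≤ n * W1 (μ₁ + ν) (μ₂ + ν) := by
  induction n with
  | zero =>
    simp [W1_self]
  | succ n ih =>
    have h₁ : ((n + 1 : ℕ) : NNReal) • μ₁ + ν = ((n : NNReal) • μ₁ + ν) + μ₁ := by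
      push_cast
      rw [add_smul, one_smul]
      abel
    have h₂ : ((n + 1 : ℕ) : NNReal) • μ₂ + ν = (μ₂ + ν) + (n : NNReal) • μ₂ := by
      push_cast
      rw [add_smul, one_smul]
      abel
    have h₃ : ((n : NNReal) • μ₂ + ν) + μ₁ = (μ₁ + ν) + (n : NNReal) • μ₂ := by abel
    rw [h₁, h₂]
    refine (W1_triangle _ (((n : NNReal) • μ₂ + ν) + μ₁) _).trans ?_
    push_cast
    rw [add_mul, one_mul]
    refine add_le_add ((W1_add_right_le _ _ _).trans ih) ?_
    rw [h₃]
    exact W1_add_right_le _ _ _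

theorem W1_add_inv_smul_le [BorelSpace X] [Nonempty X] (μ₁ μ₂ ν : Measure X)
    [IsFiniteMeasure μ₁] [IsFiniteMeasure μ₂] [IsFiniteMeasure ν] {n : ℕ} (hn : n ≠ 0) :
    W1 (μ₁ + (n : NNReal)⁻¹ • ν) (μ₂ + (n : NNReal)⁻¹ • ν) ≤ W1 (μ₁ + ν) (μ₂ + ν) := by
  have hn' : (n : NNReal) ≠ 0 := by exact_mod_cast hn
  have h : ∀ μ : Measure X, μ + (n : NNReal)⁻¹ • ν = (n : NNReal)⁻¹ • ((n : NNReal) • μ + ν) :=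
    fun μ ↦ by rw [smul_add, smul_smul, inv_mul_cancel₀ hn', one_smul]
  rw [h, h]
  refine (W1_smul_le _ _ _).trans
    ((mul_le_mul_right (W1_natCast_smul_add_le μ₁ μ₂ ν n) _).trans ?_)
  rw [← mul_assoc, ENNReal.coe_inv hn', ENNReal.coe_natCast,
    ENNReal.inv_mul_cancel (by exact_mod_cast hn) (ENNReal.natCast_ne_top n), one_mul]

theorem W1_le_lintegral_edist [BorelSpace X] {μ ν : Measure X} [IsFiniteMeasure μ]
    [IsFiniteMeasure ν] (h : μ Set.univ = ν Set.univ) (z : X) :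
    W1 μ ν ≤ ∫⁻ x, edist z x ∂μ + ∫⁻ x, edist z x ∂ν := by
  rcases eq_or_ne (μ Set.univ) 0 with h₀ | h₀
  · rw [Measure.measure_univ_eq_zero.1 h₀, Measure.measure_univ_eq_zero.1 (h.symm.trans h₀),
      W1_self]
    exact zero_le
  have hc : (μ Set.univ)⁻¹ * μ Set.univ = 1 := ENNReal.inv_mul_cancel h₀ (measure_ne_top _ _)
  have hz : Measurable fun x : X ↦ edist z x := by fun_prop
  refine (W1_le_lintegral (r := (μ Set.univ)⁻¹ • μ.prod ν) ?_ ?_).trans ?_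
  · rw [Measure.map_smul, Measure.map_fst_prod, ← h, smul_smul, hc, one_smul]
  · rw [Measure.map_smul, Measure.map_snd_prod, smul_smul, hc, one_smul]
  have hle : ∫⁻ w, edist w.1 w.2 ∂(μ.prod ν) ≤
      μ Set.univ * (∫⁻ x, edist z x ∂μ + ∫⁻ x, edist z x ∂ν) := by
    calc ∫⁻ w, edist w.1 w.2 ∂(μ.prod ν) ≤ ∫⁻ w, edist z w.1 + edist z w.2 ∂(μ.prod ν) :=
          lintegral_mono fun w ↦ edist_triangle_left _ _ _
      _ = ∫⁻ x, edist z x ∂((μ.prod ν).map Prod.fst) +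
          ∫⁻ x, edist z x ∂((μ.prod ν).map Prod.snd) := by
        rw [lintegral_add_left (f := fun w : X × X ↦ edist z w.1) (hz.comp measurable_fst),
          lintegral_map hz measurable_fst, lintegral_map hz measurable_snd]
      _ = μ Set.univ * (∫⁻ x, edist z x ∂μ + ∫⁻ x, edist z x ∂ν) := by
        rw [Measure.map_fst_prod, Measure.map_snd_prod, lintegral_smul_measure,
          lintegral_smul_measure, smul_eq_mul, smul_eq_mul, ← h, mul_add]
  rw [lintegral_smul_measure, smul_eq_mul]
  refine (mul_le_mul_right hle _).trans ?_
  rw [← mul_assoc, hc, one_mul]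

theorem add_le_one_add_mul_of_le_one {a b : ℝ≥0∞} (ha : a ≤ 1) (hb : b ≤ 1) :
    a + b ≤ 1 + a * b := by
  lift a to NNReal using ne_top_of_le_ne_top ENNReal.one_ne_top ha
  lift b to NNReal using ne_top_of_le_ne_top ENNReal.one_ne_top hb
  norm_cast at ha hb ⊢
  rw [← NNReal.coe_le_coe] at ha hb ⊢
  push_cast at ha hb ⊢
  nlinarith

theorem lintegral_le_lintegral_sub_add {α : Type*} [MeasurableSpace α] {μ ν : Measure α}
    (h : μ ≤ ν) (f : α → ℝ≥0∞) (K : ℝ≥0∞) :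
    ∫⁻ x, f x ∂μ ≤ ∫⁻ x, f x - K ∂ν + K * μ Set.univ :=
  calc ∫⁻ x, f x ∂μ ≤ ∫⁻ x, (f x - K) + K ∂μ := lintegral_mono fun x ↦ le_tsub_add
    _ = ∫⁻ x, f x - K ∂μ + K * μ Set.univ := by
      rw [lintegral_add_right _ measurable_const, lintegral_const]
    _ ≤ _ := by gcongr

/-- A coupling of `μ₁ + η` and `μ₂ + η` contains a partial coupling of `μ₁` and `μ₂` that misses
at most the mass of `η`. -/
theorem exists_partial_coupling {α β : Type*} [MeasurableSpace α] [MeasurableSpace β]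
    {μ₁ η₁ : Measure α} {μ₂ η₂ : Measure β} [IsFiniteMeasure μ₁] [IsFiniteMeasure η₁]
    [IsFiniteMeasure μ₂] [IsFiniteMeasure η₂] {r : Measure (α × β)}
    (h₁ : r.map Prod.fst = μ₁ + η₁) (h₂ : r.map Prod.snd = μ₂ + η₂) :
    ∃ r' ≤ r, r'.map Prod.fst ≤ μ₁ ∧ r'.map Prod.snd ≤ μ₂ ∧
      μ₂ Set.univ ≤ r' Set.univ + η₁ Set.univ := by
  have := isFiniteMeasure_of_map_fst h₁
  set f := μ₁.rnDeriv (r.map Prod.fst) with hf_def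
  set g := μ₂.rnDeriv (r.map Prod.snd) with hg_def
  have hle₁ : μ₁ ≤ r.map Prod.fst := h₁ ▸ Measure.le_add_right le_rfl
  have hle₂ : μ₂ ≤ r.map Prod.snd := h₂ ▸ Measure.le_add_right le_rfl
  have hfm : Measurable f := Measure.measurable_rnDeriv _ _
  have hgm : Measurable g := Measure.measurable_rnDeriv _ _
  have hf : ∀ᵐ w ∂r, f w.1 ≤ 1 :=
    ae_of_ae_map measurable_fst.aemeasurable (Measure.rnDeriv_le_one_of_le hle₁)
  have hg : ∀ᵐ w ∂r, g w.2 ≤ 1 :=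
    ae_of_ae_map measurable_snd.aemeasurable (Measure.rnDeriv_le_one_of_le hle₂)
  have hfA : ∀ A, MeasurableSet A → ∫⁻ w in Prod.fst ⁻¹' A, f w.1 ∂r = μ₁ A := fun A hA ↦ by
    rw [← setLIntegral_map hA hfm measurable_fst,
      Measure.setLIntegral_rnDeriv (Measure.absolutelyContinuous_of_le hle₁)]
  have hgB : ∀ B, MeasurableSet B → ∫⁻ w in Prod.snd ⁻¹' B, g w.2 ∂r = μ₂ B := fun B hB ↦ by
    rw [← setLIntegral_map hB hgm measurable_snd,
      Measure.setLIntegral_rnDeriv (Measure.absolutelyContinuous_of_le hle₂)]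
  refine ⟨r.withDensity fun w ↦ f w.1 * g w.2, ?_, ?_, ?_, ?_⟩
  · conv_rhs => rw [← withDensity_one (μ := r)]
    refine withDensity_mono ?_
    filter_upwards [hf, hg] with w hw hw'
    exact mul_le_one' hw hw'
  · refine Measure.le_iff.2 fun A hA ↦ ?_
    rw [Measure.map_apply measurable_fst hA, withDensity_apply _ (measurable_fst hA), ← hfA A hA]
    refine lintegral_mono_ae (ae_restrict_of_ae ?_)
    filter_upwards [hg] with w hw
    exact mul_le_of_le_one_right' hw
  · refine Measure.le_iff.2 fun B hB ↦ ?_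
    rw [Measure.map_apply measurable_snd hB, withDensity_apply _ (measurable_snd hB), ← hgB B hB]
    refine lintegral_mono_ae (ae_restrict_of_ae ?_)
    filter_upwards [hf] with w hw
    exact mul_le_of_le_one_left' hw
  · have hr : r Set.univ = μ₁ Set.univ + η₁ Set.univ := by
      rw [← Set.preimage_univ (f := Prod.fst), ← Measure.map_apply measurable_fst .univ, h₁]
      rfl
    have hint : ∫⁻ w, f w.1 + g w.2 ∂r ≤ ∫⁻ w, 1 + f w.1 * g w.2 ∂r := by
      refine lintegral_mono_ae ?_
      filter_upwards [hf, hg] with w hw hw'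
      exact add_le_one_add_mul_of_le_one hw hw'
    have hf_univ := hfA _ .univ
    have hg_univ := hgB _ .univ
    simp only [Set.preimage_univ, Measure.restrict_univ] at hf_univ hg_univ
    rw [lintegral_add_left (f := fun w : α × β ↦ f w.1) (hfm.comp measurable_fst),
      lintegral_add_left measurable_const, lintegral_one, hf_univ, hg_univ, hr, add_assoc] at hint
    rw [withDensity_apply _ .univ, Measure.restrict_univ, add_comm]
    exact (ENNReal.add_le_add_iff_left (measure_ne_top μ₁ _)).1 hint

theorem W1_le_W1_add_right_add [BorelSpace X] {μ₁ μ₂ : Measure X} [IsFiniteMeasure μ₁]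
    [IsFiniteMeasure μ₂] (h : μ₁ Set.univ = μ₂ Set.univ) (η : Measure X) [IsFiniteMeasure η]
    (z : X) (K : ℝ≥0∞) :
    W1 μ₁ μ₂ ≤ W1 (μ₁ + η) (μ₂ + η) + ((∫⁻ x, edist z x - K ∂μ₁ + K * η Set.univ) +
      (∫⁻ x, edist z x - K ∂μ₂ + K * η Set.univ)) := by
  rw [W1.eq_def (μ₁ + η)]
  simp only [ENNReal.iInf_add]
  refine le_iInf₂ fun r ⟨h₁, h₂⟩ ↦ ?_
  obtain ⟨r', hr', hle₁, hle₂, hmass⟩ := exists_partial_coupling h₁ h₂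
  have := isFiniteMeasure_of_map_fst h₁
  have : IsFiniteMeasure r' := isFiniteMeasure_of_le r hr'
  have huniv₁ : r'.map Prod.fst Set.univ = r' Set.univ := Measure.map_apply measurable_fst .univ
  have huniv₂ : r'.map Prod.snd Set.univ = r' Set.univ := Measure.map_apply measurable_snd .univ
  have hsub₁ : (μ₁ - r'.map Prod.fst) Set.univ = μ₂ Set.univ - r' Set.univ := by
    rw [Measure.sub_apply .univ hle₁, huniv₁, h]
  have hsub₂ : (μ₂ - r'.map Prod.snd) Set.univ = μ₂ Set.univ - r' Set.univ := by
    rw [Measure.sub_apply .univ hle₂, huniv₂]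
  have hsub_le : μ₂ Set.univ - r' Set.univ ≤ η Set.univ := tsub_le_iff_left.2 hmass
  calc W1 μ₁ μ₂ = W1 (r'.map Prod.fst + (μ₁ - r'.map Prod.fst))
        (r'.map Prod.snd + (μ₂ - r'.map Prod.snd)) := by
        rw [add_comm, Measure.sub_add_cancel_of_le hle₁, add_comm (r'.map Prod.snd),
          Measure.sub_add_cancel_of_le hle₂]
    _ ≤ W1 (r'.map Prod.fst) (r'.map Prod.snd) +
        W1 (μ₁ - r'.map Prod.fst) (μ₂ - r'.map Prod.snd) := W1_add_add_le _ _ _ _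
    _ ≤ _ := by
      refine add_le_add ((W1_le_lintegral rfl rfl).trans (lintegral_mono' hr' le_rfl))
        ((W1_le_lintegral_edist (hsub₁.trans hsub₂.symm) z).trans (add_le_add ?_ ?_))
      · refine (lintegral_le_lintegral_sub_add Measure.sub_le _ K).trans ?_
        rw [hsub₁]
        gcongr
      · refine (lintegral_le_lintegral_sub_add Measure.sub_le _ K).trans ?_
        rw [hsub₂]
        gcongr

theorem tendsto_lintegral_sub_natCast {α : Type*} [MeasurableSpace α] {μ : Measure α}
    {f : α → ℝ≥0∞} (hf : Measurable f) (hfin : ∫⁻ x, f x ∂μ ≠ ∞) :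
    Filter.Tendsto (fun n : ℕ ↦ ∫⁻ x, f x - n ∂μ) Filter.atTop (nhds 0) := by
  rw [← lintegral_zero (μ := μ)]
  refine tendsto_lintegral_of_dominated_convergence f (fun n ↦ hf.sub measurable_const)
    (fun n ↦ .of_forall fun x ↦ tsub_le_self) hfin ?_
  filter_upwards [ae_lt_top hf hfin] with x hx
  obtain ⟨N, hN⟩ := ENNReal.exists_nat_gt hx.ne
  refine tendsto_const_nhds.congr' ?_
  filter_upwards [Filter.eventually_ge_atTop N] with n hn
  exact (tsub_eq_zero_of_le (hN.le.trans (by exact_mod_cast hn))).symm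

/-- A common summand can be cancelled in the 1-Wasserstein distance. -/
theorem W1_le_W1_add_right [BorelSpace X] {μ₁ μ₂ : Measure X} [IsFiniteMeasure μ₁]
    [IsFiniteMeasure μ₂] (h : μ₁ Set.univ = μ₂ Set.univ) (ν : Measure X) [IsFiniteMeasure ν]
    (z : X) (h₁ : ∫⁻ x, edist z x ∂μ₁ ≠ ∞) (h₂ : ∫⁻ x, edist z x ∂μ₂ ≠ ∞) :
    W1 μ₁ μ₂ ≤ W1 (μ₁ + ν) (μ₂ + ν) := by
  have : Nonempty X := ⟨z⟩
  have hz : Measurable fun x : X ↦ edist z x := by fun_prop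
  have htrunc : ∀ k : ℕ, W1 μ₁ μ₂ ≤ W1 (μ₁ + ν) (μ₂ + ν) +
      (∫⁻ x, edist z x - k ∂μ₁ + ∫⁻ x, edist z x - k ∂μ₂) := fun k ↦ by
    have hfin : (k : ℝ≥0∞) * ν Set.univ + k * ν Set.univ ≠ ∞ := by
      have := ENNReal.mul_ne_top (ENNReal.natCast_ne_top k) (measure_ne_top ν Set.univ)
      exact ENNReal.add_ne_top.2 ⟨this, this⟩
    refine ge_of_tendsto (tendsto_add_inv_natCast_mul _ hfin) ?_
    filter_upwards [Filter.eventually_ne_atTop 0] with n hn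
    have hn' : (n : NNReal) ≠ 0 := by exact_mod_cast hn
    refine (W1_le_W1_add_right_add h ((n : NNReal)⁻¹ • ν) z k).trans ?_
    rw [add_add_add_comm (∫⁻ x, edist z x - k ∂μ₁), ← add_assoc]
    refine add_le_add (add_le_add_left (W1_add_inv_smul_le μ₁ μ₂ ν hn) _) (le_of_eq ?_)
    rw [Measure.smul_apply, ENNReal.smul_def, smul_eq_mul, ENNReal.coe_inv hn',
      ENNReal.coe_natCast]
    ring
  refine ge_of_tendsto' (x := Filter.atTop) (f := fun k : ℕ ↦ W1 (μ₁ + ν) (μ₂ + ν) +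
    (∫⁻ x, edist z x - k ∂μ₁ + ∫⁻ x, edist z x - k ∂μ₂)) ?_ htrunc
  simpa using tendsto_const_nhds.add
    ((tendsto_lintegral_sub_natCast hz h₁).add (tendsto_lintegral_sub_natCast hz h₂))

end W1

/-- Mixing both measures with a common measure `p` with weight `1 - λ` contracts the
1-Wasserstein distance by exactly the factor `λ`. -/
theorem stmt7 {X : Type*} [MetricSpace X] [MeasurableSpace X] [BorelSpace X]
    (p q₁ q₂ : Measure X) [IsProbabilityMeasure p]
    [IsProbabilityMeasure q₁] [IsProbabilityMeasure q₂]
    (hp : ∀ z : X, ∫⁻ x, edist z x ∂p < ⊤)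
    (hq₁ : ∀ z : X, ∫⁻ x, edist z x ∂q₁ < ⊤)
    (hq₂ : ∀ z : X, ∫⁻ x, edist z x ∂q₂ < ⊤)
    (lam : NNReal) (hlam : lam ≤ 1) :
    W1 (lam • q₁ + (1 - lam) • p) (lam • q₂ + (1 - lam) • p) = (lam : ℝ≥0∞) * W1 q₁ q₂ := by
  refine le_antisymm ((W1_add_right_le _ _ _).trans (W1_smul_le _ _ _)) ?_
  rcases eq_or_ne lam 0 with rfl | hlam₀
  · simp
  obtain ⟨z⟩ : Nonempty X := p.nonempty_of_neZero
  refine (mul_W1_le hlam₀ q₁ q₂).trans (W1_le_W1_add_right (by simp) _ z ?_ ?_)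
  · rw [lintegral_smul_measure]
    exact ENNReal.mul_ne_top ENNReal.coe_ne_top (hq₁ z).ne
  · rw [lintegral_smul_measure]
    exact ENNReal.mul_ne_top ENNReal.coe_ne_top (hq₂ z).ne
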